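/- Weak-star convergence of level-set Riemann sums: Let u ∈ C_c^∞(ℝ^d). Then there exist finite collections of open sets {Ω_{n,i}}_{i=1}^n (superlevel sets of u at regular values) and scalars {a_{n,i}} such that for every Φ ∈ C_0(ℝ^d; ℝ^d), ∫_{ℝ^d} Φ · ∇u dx = lim_{n→∞} Σ_{i=1}^n a_{n,i} ∫_{ℝ^d} Φ · dDχ_{Ω_{n,i}}, and moreover limsup_{n→∞} Σ_{i=1}^n |a_{n,i}| · |Dχ_{Ω_{n,i}}|(ℝ^d) ≤ ‖∇u‖_{L¹(ℝ^d)}. -/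

import Mathlib

open MeasureTheory Topology Filter Bornology
open scoped ENNReal RealInnerProductSpace

noncomputable section

abbrev Euc (d : ℕ) : Type := EuclideanSpace ℝ (Fin d)

/-- Integral of a function against a signed measure. -/
def sInt {α : Type*} [MeasurableSpace α] (μ : MeasureTheory.SignedMeasure α) (f : α → ℝ) : ℝ :=
  (∫ x, f x ∂μ.toJordanDecomposition.posPart) - ∫ x, f x ∂μ.toJordanDecomposition.negPart

/-- `μ` is the distributional gradient (componentwise) of `u`. -/
def IsDistGrad (d : ℕ) (u : Euc d → ℝ) (μ : Fin d → MeasureTheory.SignedMeasure (Euc d)) : Prop :=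
  ∀ (l : Fin d) (φ : Euc d → ℝ), ContDiff ℝ (⊤ : ℕ∞) φ → HasCompactSupport φ →
    (∫ x, u x * fderiv ℝ φ x (EuclideanSpace.single l 1)) = - sInt (μ l) φ

/-- Euclidean total variation of a vector of signed measures, on a set `s`. -/
def vvar {d : ℕ} (μ : Fin d → MeasureTheory.SignedMeasure (Euc d)) (s : Set (Euc d)) : ℝ≥0∞ :=
  ⨆ (P : ℕ → Set (Euc d)) (_ : ∀ n, MeasurableSet (P n))
    (_ : Pairwise (Function.onFun Disjoint P)) (_ : ∀ n, P n ⊆ s),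
    ∑' n, ENNReal.ofReal (Real.sqrt (∑ l, (μ l (P n)) ^ 2))

/-- real-valued characteristic function -/
def ind {d : ℕ} (U : Set (Euc d)) : Euc d → ℝ := U.indicator fun _ => 1

/-- axis-parallel closed cube with corner `a` and side `ℓ` -/
def cube {d : ℕ} (a : Euc d) (ℓ : ℝ) : Set (Euc d) := {x | ∀ i, a i ≤ x i ∧ x i ≤ a i + ℓ}

/-- the concentric double of `cube a ℓ` -/
def cube2 {d : ℕ} (a : Euc d) (ℓ : ℝ) : Set (Euc d) :=
  {x | ∀ i, a i - ℓ / 2 ≤ x i ∧ x i ≤ a i + 3 * ℓ / 2}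

/-- dyadic cube `2^{-k}([0,1)^d + m)` -/
def dyadic (d : ℕ) (k : ℤ) (m : Fin d → ℤ) : Set (Euc d) :=
  {x | ∀ i, (m i : ℝ) ≤ 2 ^ k * x i ∧ 2 ^ k * x i < m i + 1}

/-- index of the dyadic parent cube: `dyadic d (k-1) (parentIdx m)` is the parent of `dyadic d k m` -/
def parentIdx {d : ℕ} (m : Fin d → ℤ) : Fin d → ℤ := fun i => Int.fdiv (m i) 2

/-- the heat kernel on ℝ^d -/
def heatK (d : ℕ) (t : ℝ) (x : Euc d) : ℝ :=
  (4 * Real.pi * t) ^ (-(d : ℝ) / 2) * Real.exp (-‖x‖ ^ 2 / (4 * t))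

section Sard

open Set Module
open scoped NNReal

variable {E F : Type*} [NormedAddCommGroup E] [NormedSpace ℝ E]
  [NormedAddCommGroup F] [NormedSpace ℝ F]

theorem norm_le_pow_succ_of_norm_fderiv_le_pow {g : E → F} {s : Set E} (hs : Convex ℝ s)
    (hg : ∀ x ∈ s, DifferentiableAt ℝ g x) {y : E} (hy : y ∈ s) (hgy : g y = 0) {C : ℝ}
    (hC : 0 ≤ C) {m : ℕ} (hbound : ∀ z ∈ s, ‖fderiv ℝ g z‖ ≤ C * ‖z - y‖ ^ m) {z : E} (hz : z ∈ s) :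
    ‖g z‖ ≤ C * ‖z - y‖ ^ (m + 1) := by
  have hseg : segment ℝ y z ⊆ s := hs.segment_subset hy hz
  have := (convex_segment (𝕜 := ℝ) y z).norm_image_sub_le_of_norm_fderiv_le (𝕜 := ℝ) (f := g)
    (C := C * ‖z - y‖ ^ m) (fun x hx => hg x (hseg hx)) (fun x hx => by
      refine (hbound x (hseg hx)).trans ?_
      gcongr
      obtain ⟨θ, hθ, rfl⟩ := segment_eq_image' ℝ y z ▸ hx
      rw [add_sub_cancel_left, norm_smul, Real.norm_of_nonneg hθ.1]
      exact mul_le_of_le_one_left (norm_nonneg _) hθ.2)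
    (left_mem_segment ℝ y z) (right_mem_segment ℝ y z)
  rw [hgy, sub_zero] at this
  rw [pow_succ]
  linarith

theorem norm_iteratedFDeriv_le_pow_of_flat {f : E → ℝ} {s : Set E} (hs : Convex ℝ s) {n : ℕ}
    (hf : ∀ x ∈ s, ContDiffAt ℝ (n + 1 : ℕ) f x) {y : E} (hy : y ∈ s)
    (hflat : ∀ j, 1 ≤ j → j ≤ n → iteratedFDeriv ℝ j f y = 0) {C : ℝ} (hC : 0 ≤ C)
    (hbound : ∀ z ∈ s, ‖iteratedFDeriv ℝ (n + 1) f z‖ ≤ C) :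
    ∀ i ≤ n, ∀ z ∈ s, ‖iteratedFDeriv ℝ (n + 1 - i) f z‖ ≤ C * ‖z - y‖ ^ i := by
  intro i
  induction i with
  | zero => simpa using hbound
  | succ i ih =>
    intro hi z hz
    have e : n + 1 - i = (n + 1 - (i + 1)) + 1 := by omega
    refine norm_le_pow_succ_of_norm_fderiv_le_pow hs (fun x hx => ?_) hy
      (hflat _ (by omega) (by omega)) hC (fun w hw => ?_) hz
    · exact ((hf x hx).iteratedFDeriv_right (m := 1) (i := n + 1 - (i + 1))
        (by norm_cast; omega)).differentiableAt (by simp)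
    · rw [norm_fderiv_iteratedFDeriv, ← e]
      exact ih (by omega) w hw

theorem abs_sub_le_pow_of_flat {f : E → ℝ} {s : Set E} (hs : Convex ℝ s) {n : ℕ}
    (hf : ∀ x ∈ s, ContDiffAt ℝ (n + 1 : ℕ) f x) {y : E} (hy : y ∈ s)
    (hflat : ∀ j, 1 ≤ j → j ≤ n → iteratedFDeriv ℝ j f y = 0) {C : ℝ} (hC : 0 ≤ C)
    (hbound : ∀ z ∈ s, ‖iteratedFDeriv ℝ (n + 1) f z‖ ≤ C) {z : E} (hz : z ∈ s) :
    |f z - f y| ≤ C * ‖z - y‖ ^ (n + 1) := by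
  refine norm_le_pow_succ_of_norm_fderiv_le_pow (g := fun x => f x - f y) hs (fun x hx => ?_) hy
    (sub_self _) hC (fun w hw => ?_) hz
  · exact ((hf x hx).differentiableAt (by simp)).sub_const _
  · have := norm_iteratedFDeriv_le_pow_of_flat hs hf hy hflat hC hbound n le_rfl w hw
    rw [fderiv_sub_const]
    rw [add_tsub_cancel_left] at this
    rwa [← norm_iteratedFDeriv_one]

/-- The image of the set where all derivatives of order at most `n ≥ dim E` vanish is null. -/
theorem volume_image_eq_zero_of_flat [FiniteDimensional ℝ E] {n : ℕ} (hn : finrank ℝ E ≤ n)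
    {f : E → ℝ} {A : Set E} (hf : ∀ x ∈ A, ContDiffAt ℝ (n + 1 : ℕ) f x)
    (hflat : ∀ x ∈ A, ∀ j, 1 ≤ j → j ≤ n → iteratedFDeriv ℝ j f x = 0) :
    volume (f '' A) = 0 := by
  have hr : (0 : ℝ≥0) < (n + 1 : ℕ) := by positivity
  have hdim : dimH (f '' A) ≤ dimH A / ((n + 1 : ℕ) : ℝ≥0) := by
    refine dimH_image_le_of_locally_holder_on hr fun x hx => ?_
    have h1 : ∀ᶠ y in 𝓝 x, ContDiffAt ℝ (n + 1 : ℕ) f y := (hf x hx).eventually (by simp)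
    have h2 : ContinuousAt (iteratedFDeriv ℝ (n + 1) f) x :=
      ((hf x hx).iteratedFDeriv_right (m := 0) (i := n + 1) (by simp)).continuousAt
    have h3 : ∀ᶠ y in 𝓝 x, ‖iteratedFDeriv ℝ (n + 1) f y‖ <
        ‖iteratedFDeriv ℝ (n + 1) f x‖ + 1 :=
      h2.norm.eventually (gt_mem_nhds (lt_add_one _))
    obtain ⟨δ, hδ, hball⟩ := Metric.eventually_nhds_iff_ball.1 (h1.and h3)
    set C : ℝ := ‖iteratedFDeriv ℝ (n + 1) f x‖ + 1
    have hC : 0 ≤ C := by positivity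
    refine ⟨C.toNNReal, A ∩ Metric.ball x δ, inter_mem_nhdsWithin _ (Metric.ball_mem_nhds x hδ), ?_⟩
    intro z hz y hy
    have := abs_sub_le_pow_of_flat (convex_ball x δ) (fun w hw => (hball w hw).1) hy.2
      (hflat y hy.1) hC (fun w hw => (hball w hw).2.le) hz.2
    rw [edist_dist, edist_dist, Real.dist_eq, dist_eq_norm]
    rw [NNReal.coe_natCast, ENNReal.rpow_natCast, ← ENNReal.ofReal_pow (norm_nonneg _)]
    change _ ≤ ENNReal.ofReal C * _
    rw [← ENNReal.ofReal_mul hC]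
    exact ENNReal.ofReal_le_ofReal this
  have hlt : dimH (f '' A) < (1 : ℝ≥0) := by
    refine hdim.trans_lt ?_
    refine (ENNReal.div_le_div_right ((dimH_mono (subset_univ A)).trans_eq
      (Real.dimH_univ_eq_finrank E)) _).trans_lt ?_
    rw [ENNReal.div_lt_iff (by simp) (by simp)]
    simp only [ENNReal.coe_one, one_mul, ENNReal.coe_natCast]
    exact_mod_cast Nat.lt_succ_of_le hn
  have := hausdorffMeasure_of_dimH_lt hlt
  rwa [NNReal.coe_one, hausdorffMeasure_real] at this

/-- If critical values of `C^N` functions in dimension `d` form null sets, then the critical points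
of `f` on a hypersurface `{w = 0}` in dimension `d + 1` have a null set of values. -/
theorem exists_nhds_volume_image_hypersurface_eq_zero [FiniteDimensional ℝ E]
    {d N : ℕ} (hN : 1 ≤ N) (hd : finrank ℝ E = d + 1)
    (ih : ∀ (K : Submodule ℝ E), finrank ℝ K = d → ∀ (h : K → ℝ) (B : Set K),
      (∀ x ∈ B, ContDiffAt ℝ N h x ∧ fderiv ℝ h x = 0) → volume (h '' B) = 0)
    {f w : E → ℝ} {A : Set E} {x₀ : E} (hf : ∀ x ∈ A, ContDiffAt ℝ N f x ∧ fderiv ℝ f x = 0)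
    (hw : ContDiffAt ℝ N w x₀) (hwA : ∀ x ∈ A, w x = 0) (hdw : fderiv ℝ w x₀ ≠ 0) :
    ∃ V ∈ 𝓝 x₀, volume (f '' (A ∩ V)) = 0 := by
  have : CompleteSpace E := FiniteDimensional.complete ℝ E
  set L : E →L[ℝ] ℝ := fderiv ℝ w x₀ with hL
  have hN0 : (N : WithTop ℕ∞) ≠ 0 := by exact_mod_cast (by omega : N ≠ 0)
  have hsurj : Function.Surjective L := LinearMap.surjective (f := (L : E →ₗ[ℝ] ℝ))
    (fun h => hdw (by ext v; exact DFunLike.congr_fun h v))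
  have hfr : finrank ℝ L.ker = d := by
    have h1 := L.toLinearMap.finrank_range_add_finrank_ker
    rw [LinearMap.range_eq_top.2 hsurj, finrank_top, finrank_self, hd] at h1
    exact (by omega : finrank ℝ (LinearMap.ker L.toLinearMap) = d)
  obtain ⟨P, hP⟩ := Submodule.ClosedComplemented.of_finiteDimensional (L.ker)
  have hinj : Function.Injective (L.prod P) := by
    refine (injective_iff_map_eq_zero _).2 fun v hv => ?_
    obtain ⟨h1, h2⟩ := Prod.mk.inj hv
    have := hP ⟨v, h1⟩
    rw [show P v = 0 from h2] at this
    exact congrArg Subtype.val this.symm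
  have hfin : finrank ℝ E = finrank ℝ (ℝ × L.ker) := by
    rw [finrank_prod, hfr, hd, finrank_self, add_comm]
  let e : E ≃L[ℝ] ℝ × L.ker := ContinuousLinearEquiv.ofBijective (L.prod P)
    (LinearMap.ker_eq_bot.2 hinj) (LinearMap.range_eq_top.2
      ((LinearMap.injective_iff_surjective_of_finrank_eq_finrank
        (f := (L.prod P : E →ₗ[ℝ] ℝ × L.ker)) hfin).1 hinj))
  let G : E → ℝ × L.ker := fun x => (w x, P x)
  have hG : ContDiffAt ℝ N G x₀ := hw.prodMk P.contDiff.contDiffAt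
  have hG' : HasFDerivAt G (e : E →L[ℝ] ℝ × L.ker) x₀ :=
    (hw.differentiableAt hN0).hasFDerivAt.prodMk P.hasFDerivAt
  let Φ := hG.toOpenPartialHomeomorph G hG' hN0
  have hsymm : ContDiffAt ℝ N Φ.symm (G x₀) := hG.to_localInverse hG' hN0
  have hnear : ∀ᶠ x in 𝓝 x₀, x ∈ Φ.source ∧ ContDiffAt ℝ N Φ.symm (G x) :=
    (Φ.open_source.eventually_mem (hG.mem_toOpenPartialHomeomorph_source hG' hN0)).and
      (hG.continuousAt.eventually (hsymm.eventually (by simp)))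
  let V : Set E := {x | x ∈ Φ.source ∧ ContDiffAt ℝ N Φ.symm (G x)}
  refine ⟨V, hnear, ?_⟩
  let ι : L.ker → E := fun z => Φ.symm (0, z)
  have hι : ∀ x ∈ A ∩ V, ι (P x) = x ∧ ContDiffAt ℝ N ι (P x) := by
    rintro x ⟨hxA, hxs, hxc⟩
    have hGx : G x = (0, P x) := Prod.ext (hwA x hxA) rfl
    rw [hGx] at hxc
    refine ⟨?_, hxc.comp (P x) (contDiffAt_const.prodMk contDiffAt_id)⟩
    change Φ.symm (0, P x) = x
    rw [← hGx]
    exact Φ.left_inv hxs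
  have hnull := ih L.ker hfr (f ∘ ι) (P '' (A ∩ V)) (by
    rintro _ ⟨x, hx, rfl⟩
    obtain ⟨hιx, hιc⟩ := hι x hx
    have hfx := hf x hx.1
    rw [← hιx] at hfx
    refine ⟨hfx.1.comp _ hιc, ?_⟩
    rw [fderiv_comp _ (hfx.1.differentiableAt hN0) (hιc.differentiableAt hN0), hfx.2,
      ContinuousLinearMap.zero_comp])
  refine measure_mono_null ?_ hnull
  rintro _ ⟨x, hx, rfl⟩
  exact ⟨P x, ⟨x, hx, rfl⟩, congrArg f (hι x hx).1⟩

theorem volume_image_eq_zero_of_locally {X : Type*} [TopologicalSpace X]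
    [SecondCountableTopology X] {f : X → ℝ} {A : Set X}
    (h : ∀ x ∈ A, ∃ V ∈ 𝓝 x, volume (f '' (A ∩ V)) = 0) : volume (f '' A) = 0 := by
  choose! V hV hnull using h
  obtain ⟨t, htA, htc, hcov⟩ := TopologicalSpace.countable_cover_nhdsWithin
    (s := A) (f := V) (fun x hx => mem_nhdsWithin_of_mem_nhds (hV x hx))
  refine measure_mono_null ?_ ((measure_biUnion_null_iff htc).2 fun x hx => hnull x (htA hx))
  rintro _ ⟨y, hy, rfl⟩
  obtain ⟨x, hx, hyx⟩ := mem_iUnion₂.1 (hcov hy)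
  exact mem_iUnion₂.2 ⟨x, hx, y, ⟨hy, hyx⟩, rfl⟩

/-- The **Morse–Sard theorem** for real-valued functions of finite smoothness, with a non-optimal
smoothness exponent depending on the dimension. -/
theorem exists_volume_image_critical_eq_zero (d : ℕ) : ∃ N : ℕ, 1 ≤ N ∧
    ∀ (E : Type*) [NormedAddCommGroup E] [NormedSpace ℝ E] [FiniteDimensional ℝ E],
      finrank ℝ E = d → ∀ (f : E → ℝ) (A : Set E),
        (∀ x ∈ A, ContDiffAt ℝ N f x ∧ fderiv ℝ f x = 0) → volume (f '' A) = 0 := by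
  induction d with
  | zero =>
    refine ⟨1, le_rfl, fun E _ _ _ hE f A _ => ?_⟩
    have := finrank_zero_iff.1 hE
    exact ((subsingleton_of_subsingleton (s := A)).image f).measure_zero _
  | succ d ih =>
    obtain ⟨N, hN, ih⟩ := ih
    refine ⟨N + d + 2, by omega, fun E _ _ _ hE f A hA => ?_⟩
    have hle : ∀ {m : ℕ}, m ≤ N + d + 2 → ∀ x ∈ A, ContDiffAt ℝ m f x := fun hm x hx =>
      (hA x hx).1.of_le (by exact_mod_cast hm)
    let Flat : Set E := {x ∈ A | ∀ j, 1 ≤ j → j ≤ d + 1 → iteratedFDeriv ℝ j f x = 0}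
    let S : ℕ → Set E := fun k =>
      {x ∈ A | k ≤ d ∧ iteratedFDeriv ℝ k f x = 0 ∧ iteratedFDeriv ℝ (k + 1) f x ≠ 0}
    have hcover : A ⊆ Flat ∪ ⋃ k, S k := by
      intro x hx
      by_cases hflat : ∀ j, 1 ≤ j → j ≤ d + 1 → iteratedFDeriv ℝ j f x = 0
      · exact Or.inl ⟨hx, hflat⟩
      · right
        by_contra hS
        refine hflat fun j hj => Nat.le_induction (fun _ => ?_) (fun k hk ihk hkd => ?_) j hj
        · rw [← norm_eq_zero, norm_iteratedFDeriv_one, (hA x hx).2, norm_zero]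
        · by_contra hne
          exact hS (mem_iUnion.2 ⟨k, hx, by omega, ihk (by omega), hne⟩)
    have hFlat : volume (f '' Flat) = 0 :=
      volume_image_eq_zero_of_flat (n := d + 1) hE.le (fun x hx => hle (by omega) x hx.1)
        fun x hx => hx.2
    have hS : ∀ k, volume (f '' S k) = 0 := by
      refine fun k => volume_image_eq_zero_of_locally fun x₀ hx₀ => ?_
      obtain ⟨hx₀A, hkd, hk0, hk1⟩ := hx₀
      have hW : ContDiffAt ℝ N (iteratedFDeriv ℝ k f) x₀ :=
        (hle le_rfl x₀ hx₀A).iteratedFDeriv_right (by norm_cast; omega)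
      have hW' : fderiv ℝ (iteratedFDeriv ℝ k f) x₀ ≠ 0 := by
        refine fun h0 => hk1 (norm_eq_zero.1 ?_)
        rw [← norm_fderiv_iteratedFDeriv, h0]
        exact norm_zero (E := E →L[ℝ] E [×k]→L[ℝ] ℝ)
      obtain ⟨v, hv⟩ := DFunLike.exists_ne hW'
      obtain ⟨m, hm⟩ := DFunLike.exists_ne hv
      let ev : (E [×k]→L[ℝ] ℝ) →L[ℝ] ℝ := ContinuousMultilinearMap.apply ℝ (fun _ : Fin k => E) ℝ m
      refine exists_nhds_volume_image_hypersurface_eq_zero hN hE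
        (fun K hK h B hB => ih K hK h B hB) (w := fun x => ev (iteratedFDeriv ℝ k f x))
        (fun x hx => ⟨hle (by omega) x hx.1, (hA x hx.1).2⟩)
        (ev.contDiff.contDiffAt.comp x₀ hW) (fun x hx => by simp [hx.2.2.1]) fun h0 => hm ?_
      have hd := hW.differentiableAt (by exact_mod_cast (by omega : N ≠ 0))
      have := (ev.hasFDerivAt.comp x₀ hd.hasFDerivAt).fderiv
      exact (DFunLike.congr_fun (this.symm.trans h0) v)
    refine measure_mono_null ((image_mono hcover).trans (image_union ..).subset) ?_
    rw [image_iUnion]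
    exact measure_union_null hFlat (measure_iUnion_null hS)

end Sard

section SignedDensity

theorem abs_indicator_one_le {X : Type*} (A : Set X) (x : X) :
    |A.indicator (fun _ => (1 : ℝ)) x| ≤ 1 := by
  by_cases hx : x ∈ A <;> simp [hx]

variable {X : Type*} [MeasurableSpace X]

theorem integral_withDensity_ofReal {μ : Measure X} {g : X → ℝ} (hg : Integrable g μ) (f : X → ℝ) :
    ∫ x, f x ∂μ.withDensity (fun x => ENNReal.ofReal (g x)) = ∫ x, max (g x) 0 * f x ∂μ := by
  rw [integral_withDensity_eq_integral_toReal_smul₀ hg.aemeasurable.ennreal_ofReal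
    (ae_of_all _ fun x => ENNReal.ofReal_lt_top)]
  simp only [ENNReal.toReal_ofReal', smul_eq_mul]

theorem integral_withDensity_ofReal_sub {μ : Measure X} {g : X → ℝ} (hg : Integrable g μ)
    {f : X → ℝ} (hf : Measurable f) {C : ℝ} (hC : ∀ x, |f x| ≤ C) :
    ∫ x, f x ∂μ.withDensity (fun x => ENNReal.ofReal (g x)) -
      ∫ x, f x ∂μ.withDensity (fun x => ENNReal.ofReal (-g x)) = ∫ x, f x * g x ∂μ := by
  rw [integral_withDensity_ofReal hg, show (fun x => ENNReal.ofReal (-g x)) =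
    fun x => ENNReal.ofReal ((-g) x) from rfl, integral_withDensity_ofReal hg.neg,
    ← integral_sub (hg.pos_part.mul_bdd (c := C) hf.aestronglyMeasurable (ae_of_all _ hC))
      (hg.neg.pos_part.mul_bdd (c := C) hf.aestronglyMeasurable (ae_of_all _ hC))]
  refine integral_congr_ae (ae_of_all _ fun x => ?_)
  change max (g x) 0 * f x - max (-g x) 0 * f x = f x * g x
  rw [← sub_mul, ← posPart_def, ← negPart_def, posPart_sub_negPart, mul_comm]

theorem integrable_of_abs_le {μ : Measure X} [IsFiniteMeasure μ] {f : X → ℝ} (hf : Measurable f)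
    {C : ℝ} (hC : ∀ x, |f x| ≤ C) : Integrable f μ :=
  Integrable.of_bound hf.aestronglyMeasurable C (ae_of_all _ hC)

/-- The integral against a signed measure with density `g` is the integral of the product. -/
theorem sInt_eq_integral_mul {μ : Measure X} {g : X → ℝ} (hg : Integrable g μ)
    {f : X → ℝ} (hf : Measurable f) {C : ℝ} (hC : ∀ x, |f x| ≤ C) :
    sInt (μ.withDensityᵥ g) f = ∫ x, f x * g x ∂μ := by
  set j := SignedMeasure.toJordanDecomposition (μ.withDensityᵥ g) with hj
  have hfin : IsFiniteMeasure (μ.withDensity fun x => ENNReal.ofReal (g x)) :=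
    isFiniteMeasure_withDensity_ofReal hg.2
  have hfin' : IsFiniteMeasure (μ.withDensity fun x => ENNReal.ofReal (-g x)) :=
    isFiniteMeasure_withDensity_ofReal hg.neg.2
  have hmeas : j.posPart + (μ.withDensity fun x => ENNReal.ofReal (-g x)) =
      j.negPart + μ.withDensity fun x => ENNReal.ofReal (g x) := by
    refine Measure.ext fun A hA => ?_
    refine (ENNReal.toReal_eq_toReal_iff' (measure_ne_top _ _) (measure_ne_top _ _)).1 ?_
    have h1 : j.toSignedMeasure A = ∫ x in A, g x ∂μ := by
      rw [hj, SignedMeasure.toSignedMeasure_toJordanDecomposition, withDensityᵥ_apply hg hA]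
    have h2 := integral_withDensity_ofReal_sub hg (measurable_const.indicator hA)
      (abs_indicator_one_le A)
    rw [integral_indicator_const _ hA, integral_indicator_const _ hA] at h2
    rw [JordanDecomposition.toSignedMeasure, _root_.sub_apply,
      Measure.toSignedMeasure_apply_measurable hA, Measure.toSignedMeasure_apply_measurable hA,
      ← integral_indicator hA] at h1
    have h3 : ∀ x, A.indicator (fun _ => (1 : ℝ)) x * g x = A.indicator g x := fun x => by
      by_cases hx : x ∈ A <;> simp [hx]
    simp only [h3, smul_eq_mul, mul_one] at h2
    change (j.posPart + _).real A = (j.negPart + _).real A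
    rw [measureReal_add_apply, measureReal_add_apply]
    linarith
  have h := congrArg (fun m => ∫ x, f x ∂m) hmeas
  rw [integral_add_measure (integrable_of_abs_le hf hC) (integrable_of_abs_le hf hC),
    integral_add_measure (integrable_of_abs_le hf hC) (integrable_of_abs_le hf hC)] at h
  rw [← integral_withDensity_ofReal_sub hg hf hC, sInt, ← hj]
  linarith

/-- Two integrable densities defining the same functional on bounded continuous functions define
the same signed measure. -/
theorem setIntegral_eq_of_forall_integral_mul_eq [TopologicalSpace X] [HasOuterApproxClosed X]
    [BorelSpace X] {μ ν : Measure X} {g h : X → ℝ} (hg : Integrable g μ) (hh : Integrable h ν)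
    (H : ∀ ψ : BoundedContinuousFunction X ℝ, ∫ x, ψ x * g x ∂μ = ∫ x, ψ x * h x ∂ν)
    {A : Set X} (hA : MeasurableSet A) : ∫ x in A, g x ∂μ = ∫ x in A, h x ∂ν := by
  have hg₁ : IsFiniteMeasure (μ.withDensity fun x => ENNReal.ofReal (g x)) :=
    isFiniteMeasure_withDensity_ofReal hg.2
  have hg₂ : IsFiniteMeasure (μ.withDensity fun x => ENNReal.ofReal (-g x)) :=
    isFiniteMeasure_withDensity_ofReal hg.neg.2
  have hh₁ : IsFiniteMeasure (ν.withDensity fun x => ENNReal.ofReal (h x)) :=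
    isFiniteMeasure_withDensity_ofReal hh.2
  have hh₂ : IsFiniteMeasure (ν.withDensity fun x => ENNReal.ofReal (-h x)) :=
    isFiniteMeasure_withDensity_ofReal hh.neg.2
  have hmeas : (μ.withDensity fun x => ENNReal.ofReal (g x)) +
      (ν.withDensity fun x => ENNReal.ofReal (-h x)) =
      (ν.withDensity fun x => ENNReal.ofReal (h x)) +
      (μ.withDensity fun x => ENNReal.ofReal (-g x)) := by
    refine ext_of_forall_integral_eq_of_IsFiniteMeasure fun ψ => ?_
    have hψ : Measurable ψ := ψ.continuous.measurable
    have hb : ∀ x, |ψ x| ≤ ‖ψ‖ := fun x => ψ.norm_coe_le_norm x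
    rw [integral_add_measure (integrable_of_abs_le hψ hb) (integrable_of_abs_le hψ hb),
      integral_add_measure (integrable_of_abs_le hψ hb) (integrable_of_abs_le hψ hb)]
    have h1 := integral_withDensity_ofReal_sub hg hψ hb
    have h2 := integral_withDensity_ofReal_sub hh hψ hb
    have h3 := H ψ
    linarith
  have hf : Measurable (A.indicator fun _ => (1 : ℝ)) := measurable_const.indicator hA
  have hb := abs_indicator_one_le A
  have h := congrArg (fun m => ∫ x, A.indicator (fun _ => (1 : ℝ)) x ∂m) hmeas
  rw [integral_add_measure (integrable_of_abs_le hf hb) (integrable_of_abs_le hf hb),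
    integral_add_measure (integrable_of_abs_le hf hb) (integrable_of_abs_le hf hb)] at h
  have h1 := integral_withDensity_ofReal_sub hg hf hb
  have h2 := integral_withDensity_ofReal_sub hh hf hb
  have h3 : ∀ (k : X → ℝ) (x : X), A.indicator (fun _ => (1 : ℝ)) x * k x = A.indicator k x :=
    fun k x => by by_cases hx : x ∈ A <;> simp [hx]
  simp only [h3] at h1 h2
  rw [← integral_indicator hA, ← integral_indicator hA]
  linarith

end SignedDensity

section Disintegration

/-- If `h · η = g · vol` on the real line, then `g = p h` almost everywhere, where `p` is the
Radon–Nikodym derivative of `η`. -/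
theorem ae_eq_rnDeriv_mul {η : Measure ℝ} [IsFiniteMeasure η] {h g : ℝ → ℝ} (hh : Integrable h η)
    (hg : Integrable g)
    (H : ∀ ψ : BoundedContinuousFunction ℝ ℝ, ∫ t, ψ t * h t ∂η = ∫ t, ψ t * g t) :
    ∀ᵐ t, g t = (η.rnDeriv volume t).toReal * h t := by
  obtain ⟨N, hN, hsing, hvol⟩ := η.mutuallySingular_singularPart volume
  have hdec := η.haveLebesgueDecomposition_add volume
  have hlt := η.rnDeriv_lt_top (volume : Measure ℝ)
  have hle : (volume : Measure ℝ).withDensity (η.rnDeriv volume) ≤ η :=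
    η.withDensity_rnDeriv_le volume
  have hint : Integrable (fun t => (η.rnDeriv volume t).toReal * h t) :=
    (integrable_withDensity_iff_integrable_smul' (η.measurable_rnDeriv volume) hlt).1
      (hh.mono_measure hle)
  refine hg.ae_eq_of_forall_setIntegral_eq _ _ hint fun A hA _ => ?_
  have hAN : ((A ∩ N : Set ℝ) : Set ℝ) =ᵐ[volume] A :=
    inter_ae_eq_left_of_ae_eq_univ (ae_eq_univ.2 hvol)
  have hres : η.restrict (A ∩ N) =
      ((volume : Measure ℝ).withDensity (η.rnDeriv volume)).restrict (A ∩ N) := by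
    conv_lhs => rw [hdec]
    rw [Measure.restrict_add, Measure.restrict_eq_zero.2
      (measure_mono_null Set.inter_subset_right hsing), zero_add]
  rw [← setIntegral_congr_set hAN, ← setIntegral_congr_set hAN,
    ← setIntegral_eq_of_forall_integral_mul_eq hh hg H (hA.inter hN), hres,
    restrict_withDensity (hA.inter hN),
    integral_withDensity_eq_integral_toReal_smul (η.measurable_rnDeriv volume)
      (ae_restrict_of_ae hlt)]
  rfl

/-- Disintegration of a finite measure along the level sets of a real function, keeping only the
absolutely continuous part of the image measure. -/
theorem exists_levelset_disintegration {X : Type*} [MeasurableSpace X] [StandardBorelSpace X]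
    [Nonempty X] (μ : Measure X) [IsFiniteMeasure μ] {u : X → ℝ} (hu : Measurable u) :
    ∃ (p : ℝ → ℝ) (κ : ℝ → Measure X), (∀ t, 0 ≤ p t) ∧ Integrable p ∧
      ∫ t, p t ≤ μ.real Set.univ ∧ (∀ t, IsProbabilityMeasure (κ t)) ∧
      ∀ (f : X → ℝ) (C : ℝ) (g : ℝ → ℝ), Measurable f → (∀ x, |f x| ≤ C) → Integrable g →
        (∀ ψ : BoundedContinuousFunction ℝ ℝ, ∫ x, ψ (u x) * f x ∂μ = ∫ t, ψ t * g t) →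
        ∀ᵐ t, g t = p t * ∫ x, f x ∂κ t := by
  have hm : Measurable fun x => (u x, x) := hu.prodMk measurable_id
  set ρ : Measure (ℝ × X) := μ.map fun x => (u x, x)
  have hρ : IsFiniteMeasure ρ := inferInstance
  have hρuniv : ρ.fst Set.univ = μ Set.univ := by
    rw [Measure.fst_univ, Measure.map_apply hm MeasurableSet.univ, Set.preimage_univ]
  have hle : ∫⁻ t, ρ.fst.rnDeriv volume t ≤ μ Set.univ :=
    Measure.lintegral_rnDeriv_le.trans_eq hρuniv
  refine ⟨fun t => (ρ.fst.rnDeriv volume t).toReal, fun t => ρ.condKernel t,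
    fun t => ENNReal.toReal_nonneg, Measure.integrable_toReal_rnDeriv, ?_, fun t => inferInstance,
    fun f C g hf hC hg H => ?_⟩
  · rw [integral_toReal (ρ.fst.measurable_rnDeriv volume).aemeasurable
      (ρ.fst.rnDeriv_lt_top volume)]
    exact ENNReal.toReal_mono (measure_ne_top _ _) hle
  · have hf2 : Measurable fun z : ℝ × X => f z.2 := hf.comp measurable_snd
    have hint : Integrable (fun z : ℝ × X => f z.2) ρ :=
      integrable_of_abs_le hf2 fun z => hC z.2
    refine ae_eq_rnDeriv_mul hint.integral_condKernel hg fun ψ => ?_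
    have hψ : Integrable (fun z : ℝ × X => ψ z.1 * f z.2) ρ :=
      hint.bdd_mul (c := ‖ψ‖) (ψ.continuous.measurable.comp measurable_fst).aestronglyMeasurable
        (ae_of_all _ fun z => ψ.norm_coe_le_norm z.1)
    have h1 := Measure.integral_condKernel hψ
    simp only [integral_const_mul] at h1
    rw [h1, ← H ψ, integral_map hm.aemeasurable hψ.aestronglyMeasurable]

end Disintegration

section LevelSets

variable {d : ℕ}

theorem integrable_fderiv_apply {φ : Euc d → ℝ} (hφ : ContDiff ℝ 1 φ) (hc : HasCompactSupport φ)
    (v : Euc d) : Integrable fun x => fderiv ℝ φ x v :=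
  ((hφ.continuous_fderiv one_ne_zero).clm_apply continuous_const).integrable_of_hasCompactSupport
    (hc.fderiv_apply ℝ v)

theorem integral_fderiv_apply_eq_zero {φ : Euc d → ℝ} (hφ : ContDiff ℝ 1 φ)
    (hc : HasCompactSupport φ) (v : Euc d) : ∫ x, fderiv ℝ φ x v = 0 := by
  have h := integral_mul_fderiv_eq_neg_fderiv_mul_of_integrable (μ := (volume : Measure (Euc d)))
    (f := fun _ => (1 : ℝ)) (g := φ) (v := v) (by simp)
    (by simpa using integrable_fderiv_apply hφ hc v)
    (by simpa using hφ.continuous.integrable_of_hasCompactSupport hc)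
    (fun x _ => differentiableAt_const _) fun x _ =>
      hφ.differentiable one_ne_zero x
  simpa using h

theorem integrable_indicator_superlevel_prod {u h : Euc d → ℝ} (hu : Continuous u)
    (hh : Integrable h) {k : ℝ → ℝ} {ν : Measure ℝ} [SFinite ν] (hk : Integrable k ν) :
    Integrable (fun z : Euc d × ℝ => ({x | z.2 < u x}.indicator h z.1) * k z.2)
      (volume.prod ν) := by
  have h1 : MeasurableSet {z : Euc d × ℝ | z.2 < u z.1} :=
    (isOpen_lt continuous_snd (hu.comp continuous_fst)).measurableSet
  refine ((hh.mul_prod hk).indicator h1).congr (ae_of_all _ fun z => ?_)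
  by_cases hz : z.2 < u z.1 <;> simp [Set.indicator, hz]

theorem measurableSet_superlevel {u : Euc d → ℝ} (hu : Continuous u) (t : ℝ) :
    MeasurableSet {x | t < u x} :=
  (isOpen_lt continuous_const hu).measurableSet

/-- The layer-cake formula for the integral of `h` times a primitive of `ψ` composed with `u`. -/
theorem integral_primitive_comp_mul {u h : Euc d → ℝ} (hu : Continuous u) (hh : Integrable h)
    {M : ℝ} (hM : ∀ x, |u x| < M) {ψ : ℝ → ℝ} (hψ : Continuous ψ) :
    ∫ x, (∫ t in (-M)..(u x), ψ t) * h x =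
      ∫ t in Set.Ioc (-M) M, ψ t * ∫ x in {x | t < u x}, h x := by
  have hk : Integrable ψ (volume.restrict (Set.Ioc (-M) M)) :=
    (hψ.integrableOn_Icc).mono_set Set.Ioc_subset_Icc_self
  have hsw := integral_integral_swap
    (f := fun (x : Euc d) (t : ℝ) => ({x | t < u x}.indicator h x) * ψ t)
    (integrable_indicator_superlevel_prod hu hh hk)
  have hl : ∀ x, (∫ t in (-M)..(u x), ψ t) * h x =
      ∫ t in Set.Ioc (-M) M, ({x | t < u x}.indicator h x) * ψ t := fun x => by
    have hx := abs_lt.1 (hM x)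
    rw [intervalIntegral.integral_of_le hx.1.le, integral_Ioc_eq_integral_Ioo, mul_comm,
      ← integral_const_mul, ← integral_indicator measurableSet_Ioo,
      ← integral_indicator measurableSet_Ioc]
    refine integral_congr_ae (ae_of_all _ fun t => ?_)
    by_cases h1 : t < u x
    · by_cases h2 : -M < t
      · simp [Set.indicator, h1, h2, (h1.trans hx.2).le]
      · simp [Set.indicator, h2]
    · simp [Set.indicator, h1]
  have hr : ∀ t, ψ t * ∫ x in {x | t < u x}, h x = ∫ x, ({x | t < u x}.indicator h x) * ψ t :=
    fun t => by
    rw [integral_mul_const, integral_indicator (measurableSet_superlevel hu t), mul_comm]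
  simp_rw [hl, hr]
  exact hsw

theorem setIntegral_superlevel_fderiv_eq_zero {u φ : Euc d → ℝ} (hφ : ContDiff ℝ 1 φ)
    (hc : HasCompactSupport φ) (v : Euc d) {M : ℝ} (hM : ∀ x, |u x| < M) {t : ℝ}
    (ht : t ∉ Set.Ioc (-M) M) : ∫ x in {x | t < u x}, fderiv ℝ φ x v = 0 := by
  by_cases h : t ≤ -M
  · have : {x | t < u x} = Set.univ :=
      Set.eq_univ_of_forall fun x => h.trans_lt (abs_lt.1 (hM x)).1
    rw [this, setIntegral_univ, integral_fderiv_apply_eq_zero hφ hc v]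
  · have : {x | t < u x} = ∅ := by
      refine Set.eq_empty_of_forall_notMem fun x hx => ht ⟨not_le.1 h, ?_⟩
      exact (lt_trans hx (abs_lt.1 (hM x)).2).le
    rw [this, setIntegral_empty]

theorem integrable_setIntegral_superlevel_fderiv {u φ : Euc d → ℝ} (hu : Continuous u)
    (hφ : ContDiff ℝ 1 φ) (hc : HasCompactSupport φ) (v : Euc d) {M : ℝ} (hM : ∀ x, |u x| < M) :
    Integrable fun t => ∫ x in {x | t < u x}, fderiv ℝ φ x v := by
  have h1 : Integrable (fun _ => (1 : ℝ)) (volume.restrict (Set.Ioc (-M) M)) :=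
    integrable_const _
  have h2 := (integrable_indicator_superlevel_prod hu
    (integrable_fderiv_apply hφ hc v) h1).integral_prod_right
  refine IntegrableOn.integrable_of_forall_notMem_eq_zero (s := Set.Ioc (-M) M) ?_
    fun t ht => setIntegral_superlevel_fderiv_eq_zero hφ hc v hM ht
  refine h2.congr (ae_of_all _ fun t => ?_)
  simp only [mul_one]
  rw [integral_indicator (measurableSet_superlevel hu t)]

/-- The coarea formula in weak form: level-wise integration by parts. -/
theorem integral_comp_mul_mul_fderiv {u φ : Euc d → ℝ} (hu : ContDiff ℝ 1 u)
    (hφ : ContDiff ℝ 1 φ)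
    (hc : HasCompactSupport φ) (v : Euc d) {M : ℝ} (hM : ∀ x, |u x| < M) {ψ : ℝ → ℝ}
    (hψ : Continuous ψ) :
    ∫ x, ψ (u x) * (φ x * fderiv ℝ u x v) =
      ∫ t, ψ t * -∫ x in {x | t < u x}, fderiv ℝ φ x v := by
  have hd : ∀ x, HasFDerivAt (fun x => ∫ t in (-M)..(u x), ψ t) (ψ (u x) • fderiv ℝ u x) x :=
    fun x => (hψ.integral_hasStrictDerivAt (-M) (u x)).hasDerivAt.comp_hasFDerivAt x
      (hu.differentiable one_ne_zero x).hasFDerivAt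
  have hcont : Continuous fun x => ∫ t in (-M)..(u x), ψ t :=
    continuous_iff_continuousAt.2 fun x => (hd x).continuousAt
  have hDu : Continuous fun x => fderiv ℝ u x v :=
    (hu.continuous_fderiv one_ne_zero).clm_apply continuous_const
  have hDφ : Continuous fun x => fderiv ℝ φ x v :=
    (hφ.continuous_fderiv one_ne_zero).clm_apply continuous_const
  have h := integral_mul_fderiv_eq_neg_fderiv_mul_of_integrable (μ := (volume : Measure (Euc d)))
    (f := fun x => ∫ t in (-M)..(u x), ψ t) (g := φ) (v := v)
    (by
      simp only [(hd _).fderiv, _root_.smul_apply, smul_eq_mul]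
      exact (((hψ.comp hu.continuous).mul hDu).mul
        hφ.continuous).integrable_of_hasCompactSupport hc.mul_left)
    ((hcont.mul hDφ).integrable_of_hasCompactSupport (hc.fderiv_apply ℝ v).mul_left)
    ((hcont.mul hφ.continuous).integrable_of_hasCompactSupport hc.mul_left)
    (fun x _ => (hd x).differentiableAt) fun x _ =>
      hφ.differentiable one_ne_zero x
  simp only [(hd _).fderiv, _root_.smul_apply, smul_eq_mul] at h
  rw [integral_primitive_comp_mul hu.continuous (integrable_fderiv_apply hφ hc v) hM hψ,
    setIntegral_eq_integral_of_forall_compl_eq_zero fun t ht => by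
      rw [setIntegral_superlevel_fderiv_eq_zero hφ hc v hM ht, mul_zero]] at h
  simp only [mul_neg, integral_neg]
  rw [h, neg_neg]
  exact integral_congr_ae (ae_of_all _ fun x => by ring)

end LevelSets

section Normal

variable {d : ℕ}

theorem gradient_apply (u : Euc d → ℝ) (x : Euc d) (l : Fin d) :
    gradient u x l = fderiv ℝ u x (EuclideanSpace.single l 1) := by
  rw [← inner_gradient_left, EuclideanSpace.inner_single_right]
  simp

theorem continuous_gradient {u : Euc d → ℝ} (hu : ContDiff ℝ 1 u) : Continuous (gradient u) :=
  (InnerProductSpace.toDual ℝ (Euc d)).symm.continuous.comp (hu.continuous_fderiv one_ne_zero)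

theorem gradient_eq_zero_of_notMem_tsupport {u : Euc d → ℝ} {x : Euc d} (hx : x ∉ tsupport u) :
    gradient u x = 0 := by
  have h : fderiv ℝ u x = 0 := by
    by_contra h
    exact hx (support_fderiv_subset ℝ h)
  simp [gradient, h]

theorem integrable_norm_gradient {u : Euc d → ℝ} (hu : ContDiff ℝ 1 u)
    (hc : HasCompactSupport u) : Integrable fun x => ‖gradient u x‖ :=
  (continuous_gradient hu).norm.integrable_of_hasCompactSupport <|
    HasCompactSupport.intro hc fun x hx => by
      rw [gradient_eq_zero_of_notMem_tsupport hx, norm_zero]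

/-- The normalized gradient, zero at critical points. -/
def unitNormal (u : Euc d → ℝ) (x : Euc d) : Euc d := ‖gradient u x‖⁻¹ • gradient u x

theorem norm_unitNormal_le_one (u : Euc d → ℝ) (x : Euc d) : ‖unitNormal u x‖ ≤ 1 := by
  rw [unitNormal, norm_smul, norm_inv, norm_norm]
  exact inv_mul_le_one

theorem abs_unitNormal_apply_le_one (u : Euc d → ℝ) (x : Euc d) (l : Fin d) :
    |unitNormal u x l| ≤ 1 :=
  (PiLp.norm_apply_le (unitNormal u x) l).trans (norm_unitNormal_le_one u x)

theorem measurable_unitNormal {u : Euc d → ℝ} (hu : ContDiff ℝ 1 u) :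
    Measurable (unitNormal u) :=
  (continuous_gradient hu).norm.measurable.inv.smul (continuous_gradient hu).measurable

theorem measurable_unitNormal_apply {u : Euc d → ℝ} (hu : ContDiff ℝ 1 u) (l : Fin d) :
    Measurable fun x => unitNormal u x l :=
  (EuclideanSpace.proj (𝕜 := ℝ) l).continuous.measurable.comp (measurable_unitNormal hu)

theorem norm_gradient_mul_unitNormal_apply (u : Euc d → ℝ) (x : Euc d) (l : Fin d) :
    ‖gradient u x‖ * unitNormal u x l = fderiv ℝ u x (EuclideanSpace.single l 1) := by
  rw [← gradient_apply, unitNormal, PiLp.smul_apply, smul_eq_mul, ← mul_assoc]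
  by_cases h : gradient u x = 0
  · simp [h]
  · rw [mul_inv_cancel₀ (norm_ne_zero_iff.2 h), one_mul]

theorem unitNormal_eq_zero_of_notMem_tsupport {u : Euc d → ℝ} {x : Euc d} (hx : x ∉ tsupport u) :
    unitNormal u x = 0 := by
  rw [unitNormal, gradient_eq_zero_of_notMem_tsupport hx, smul_zero]

theorem exists_seq_forall_dist_lt {T Y : Type*} [Nonempty T] [PseudoMetricSpace Y]
    [SecondCountableTopology Y] (Θ : T → Y) :
    ∃ s : ℕ → T, ∀ φ, ∀ ε > 0, ∃ n, dist (Θ φ) (Θ (s n)) < ε := by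
  let : PseudoMetricSpace T := PseudoMetricSpace.induced Θ inferInstance
  have : SecondCountableTopology T := TopologicalSpace.secondCountableTopology_induced T Y Θ
  refine ⟨TopologicalSpace.denseSeq T, fun φ ε hε => ?_⟩
  exact (TopologicalSpace.denseRange_denseSeq T).exists_dist_lt φ hε

/-- The test functions, seen in a separable space in which the value on a compact set and the
derivative in a fixed direction are controlled. -/
theorem exists_seq_test_function_approx {K : Set (Euc d)} (hK : IsCompact K) (v : Euc d) :
    ∃ s : ℕ → Euc d → ℝ, (∀ n, ContDiff ℝ 1 (s n) ∧ HasCompactSupport (s n)) ∧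
      ∀ φ : Euc d → ℝ, ContDiff ℝ 1 φ → HasCompactSupport φ → ∀ ε > 0, ∃ n,
        (∀ x ∈ K, |φ x - s n x| ≤ ε) ∧ ∫ x, |fderiv ℝ φ x v - fderiv ℝ (s n) x v| ≤ ε := by
  have : CompactSpace K := isCompact_iff_compactSpace.1 hK
  have : Fact ((1 : ℝ≥0∞) ≠ ∞) := ⟨by simp⟩
  have hne : Nonempty {φ : Euc d → ℝ // ContDiff ℝ 1 φ ∧ HasCompactSupport φ} :=
    ⟨⟨0, contDiff_const, HasCompactSupport.zero⟩⟩
  obtain ⟨s, hs⟩ := exists_seq_forall_dist_lt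
    (fun φ : {φ : Euc d → ℝ // ContDiff ℝ 1 φ ∧ HasCompactSupport φ} =>
      ((⟨K.domRestrict φ.1, φ.2.1.continuous.continuousOn.domRestrict⟩ : C(K, ℝ)),
        (integrable_fderiv_apply φ.2.1 φ.2.2 v).toL1 _))
  refine ⟨fun n => (s n).1, fun n => (s n).2, fun φ hφ hc ε hε => ?_⟩
  obtain ⟨n, hn⟩ := hs ⟨φ, hφ, hc⟩ ε hε
  rw [Prod.dist_eq, max_lt_iff] at hn
  refine ⟨n, fun x hx => ?_, ?_⟩
  · exact (ContinuousMap.dist_apply_le_dist (⟨x, hx⟩ : K)).trans hn.1.le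
  · have h := hn.2.le
    rw [dist_eq_norm, ← Integrable.toL1_sub, L1.norm_of_fun_eq_integral_norm] at h
    exact h

/-- For almost every level, the distributional gradient of the superlevel set is the unit normal
times a measure. -/
theorem exists_superlevel_disintegration {u : Euc d → ℝ} (hu : ContDiff ℝ 1 u)
    (hc : HasCompactSupport u) {M : ℝ} (hM : ∀ x, |u x| < M) :
    ∃ (p : ℝ → ℝ) (κ : ℝ → Measure (Euc d)), (∀ t, 0 ≤ p t) ∧ Integrable p ∧
      ∫ t, p t ≤ ∫ x, ‖gradient u x‖ ∧ (∀ t, IsProbabilityMeasure (κ t)) ∧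
      ∀ᵐ t, ∀ (l : Fin d) (φ : Euc d → ℝ), ContDiff ℝ 1 φ → HasCompactSupport φ →
        ∫ x in {x | t < u x}, fderiv ℝ φ x (EuclideanSpace.single l 1) =
          -(p t * ∫ x, φ x * unitNormal u x l ∂κ t) := by
  have hgrad := integrable_norm_gradient hu hc
  set μ : Measure (Euc d) := volume.withDensity fun x => ENNReal.ofReal ‖gradient u x‖ with hμ
  have hμfin : IsFiniteMeasure μ := isFiniteMeasure_withDensity_ofReal hgrad.2
  have hμint : ∀ f : Euc d → ℝ, ∫ x, f x ∂μ = ∫ x, ‖gradient u x‖ * f x := fun f => by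
    rw [hμ, integral_withDensity_ofReal hgrad]
    simp only [max_eq_left (norm_nonneg _)]
  obtain ⟨p, κ, hp0, hpi, hple, hκ, H⟩ :=
    exists_levelset_disintegration μ hu.continuous.measurable
  refine ⟨p, κ, hp0, hpi, hple.trans_eq ?_, hκ, ?_⟩
  · simpa using hμint fun _ => 1
  have key : ∀ (l : Fin d) (φ : Euc d → ℝ), ContDiff ℝ 1 φ → HasCompactSupport φ → ∀ᵐ t,
      ∫ x in {x | t < u x}, fderiv ℝ φ x (EuclideanSpace.single l 1) =
        -(p t * ∫ x, φ x * unitNormal u x l ∂κ t) := fun l φ hφ hφc => by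
    obtain ⟨C, hC⟩ := hφc.exists_bound_of_continuous hφ.continuous
    have hb : ∀ x, |φ x * unitNormal u x l| ≤ C := fun x => by
      rw [abs_mul]
      exact (mul_le_of_le_one_right (abs_nonneg _) (abs_unitNormal_apply_le_one u x l)).trans (hC x)
    have hψ : ∀ ψ : BoundedContinuousFunction ℝ ℝ, ∫ x, ψ (u x) * (φ x * unitNormal u x l) ∂μ =
        ∫ t, ψ t * -∫ x in {x | t < u x}, fderiv ℝ φ x (EuclideanSpace.single l 1) := fun ψ => by
      rw [hμint, ← integral_comp_mul_mul_fderiv hu hφ hφc _ hM ψ.continuous]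
      refine integral_congr_ae (ae_of_all _ fun x => ?_)
      simp only [← norm_gradient_mul_unitNormal_apply]
      ring
    filter_upwards [H _ C _
      (hφ.continuous.measurable.mul (measurable_unitNormal_apply hu l)) hb
      (integrable_setIntegral_superlevel_fderiv hu.continuous hφ hφc
        (EuclideanSpace.single l 1) hM).neg hψ] with t ht
    exact neg_eq_iff_eq_neg.1 ht
  refine ae_all_iff.2 fun l => ?_
  obtain ⟨s, hs, happ⟩ := exists_seq_test_function_approx (d := d) (K := tsupport u) hc
    (EuclideanSpace.single l 1)
  filter_upwards [ae_all_iff.2 fun n => key l (s n) (hs n).1 (hs n).2] with t ht φ hφ hφc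
  have := hκ t
  have hint : ∀ φ : Euc d → ℝ, ContDiff ℝ 1 φ → HasCompactSupport φ →
      Integrable (fun x => φ x * unitNormal u x l) (κ t) := fun φ hφ hφc => by
    obtain ⟨C, hC⟩ := hφc.exists_bound_of_continuous hφ.continuous
    refine integrable_of_abs_le (C := C)
      (hφ.continuous.measurable.mul (measurable_unitNormal_apply hu l)) fun x => ?_
    rw [abs_mul]
    exact (mul_le_of_le_one_right (abs_nonneg _) (abs_unitNormal_apply_le_one u x l)).trans (hC x)
  have herr : ∀ ε > 0, |(∫ x in {x | t < u x}, fderiv ℝ φ x (EuclideanSpace.single l 1)) -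
      -(p t * ∫ x, φ x * unitNormal u x l ∂κ t)| ≤ 0 + (1 + p t) * ε := fun ε hε => by
    obtain ⟨n, hn1, hn2⟩ := happ φ hφ hφc ε hε
    have hD := integrable_fderiv_apply hφ hφc (EuclideanSpace.single l 1)
    have hDs := integrable_fderiv_apply (hs n).1 (hs n).2 (EuclideanSpace.single l 1)
    have e1 : |(∫ x in {x | t < u x}, fderiv ℝ φ x (EuclideanSpace.single l 1)) -
        ∫ x in {x | t < u x}, fderiv ℝ (s n) x (EuclideanSpace.single l 1)| ≤ ε := by
      rw [← integral_sub hD.integrableOn hDs.integrableOn]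
      refine (abs_integral_le_integral_abs).trans (le_trans ?_ hn2)
      exact setIntegral_le_integral (hD.sub hDs).abs (ae_of_all _ fun x => abs_nonneg _)
    have e2 : |(∫ x, φ x * unitNormal u x l ∂κ t) - ∫ x, s n x * unitNormal u x l ∂κ t| ≤ ε := by
      rw [← integral_sub (hint φ hφ hφc) (hint _ (hs n).1 (hs n).2)]
      have h := norm_integral_le_of_norm_le_const (μ := κ t) (C := ε)
        (f := fun x => φ x * unitNormal u x l - s n x * unitNormal u x l)
        (ae_of_all _ fun x => by
          rw [← sub_mul, norm_mul, Real.norm_eq_abs, Real.norm_eq_abs]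
          by_cases hx : x ∈ tsupport u
          · exact (mul_le_of_le_one_right (abs_nonneg _)
              (abs_unitNormal_apply_le_one u x l)).trans (hn1 x hx)
          · simp [unitNormal_eq_zero_of_notMem_tsupport hx, hε.le])
      simpa using h
    have e3 : |p t * (∫ x, φ x * unitNormal u x l ∂κ t) -
        p t * ∫ x, s n x * unitNormal u x l ∂κ t| ≤ p t * ε := by
      rw [← mul_sub, abs_mul, abs_of_nonneg (hp0 t)]
      exact mul_le_mul_of_nonneg_left e2 (hp0 t)
    have e4 := ht n
    rw [abs_le] at e1 e3 ⊢
    constructor <;> linarith [e1.1, e1.2, e3.1, e3.2]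
  have h0 : |(∫ x in {x | t < u x}, fderiv ℝ φ x (EuclideanSpace.single l 1)) -
      -(p t * ∫ x, φ x * unitNormal u x l ∂κ t)| ≤ 0 := by
    have hpos : 0 < 1 + p t := by linarith [hp0 t]
    refine le_of_forall_pos_le_add fun ε hε => ?_
    have h := herr (ε / (1 + p t)) (div_pos hε hpos)
    rwa [mul_div_cancel₀ _ hpos.ne'] at h
  exact sub_eq_zero.1 (abs_nonpos_iff.1 h0)

end Normal

section LevelMeasure

variable {d : ℕ}

theorem vvar_withDensityᵥ_le {μ : Measure (Euc d)} [IsFiniteMeasure μ] {n : Euc d → Euc d}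
    (hn : Measurable n) (hn1 : ∀ x, ‖n x‖ ≤ 1) :
    vvar (fun l => μ.withDensityᵥ fun x => n x l) Set.univ ≤ μ Set.univ := by
  have hint : Integrable n μ := Integrable.of_bound hn.aestronglyMeasurable 1 (ae_of_all _ hn1)
  have hl : ∀ l, Integrable (fun x => n x l) μ := fun l =>
    (EuclideanSpace.proj (𝕜 := ℝ) l).integrable_comp hint
  refine iSup_le fun P => iSup_le fun hP => iSup_le fun hdisj => iSup_le fun _ => ?_
  refine le_trans (ENNReal.tsum_le_tsum fun k => ?_)
    ((measure_iUnion hdisj hP).symm.le.trans (measure_mono (Set.subset_univ _)))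
  have h1 : √(∑ l, ((μ.withDensityᵥ fun x => n x l) (P k)) ^ 2) = ‖∫ x in P k, n x ∂μ‖ := by
    rw [EuclideanSpace.norm_eq]
    congr 1
    refine Finset.sum_congr rfl fun l _ => ?_
    rw [withDensityᵥ_apply (hl l) (hP k), Real.norm_eq_abs, sq_abs]
    congr 1
    exact (EuclideanSpace.proj (𝕜 := ℝ) l).integral_comp_comm hint.integrableOn
  rw [h1, ← ENNReal.ofReal_toReal (measure_ne_top μ (P k))]
  refine ENNReal.ofReal_le_ofReal ?_
  have h := norm_setIntegral_le_of_norm_le_const (μ := μ) (measure_lt_top μ (P k))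
    fun x _ => hn1 x
  rwa [one_mul] at h

theorem integrable_unitNormal_apply {u : Euc d → ℝ} (hu : ContDiff ℝ 1 u) (μ : Measure (Euc d))
    [IsFiniteMeasure μ] (l : Fin d) : Integrable (fun x => unitNormal u x l) μ :=
  integrable_of_abs_le (measurable_unitNormal_apply hu l) fun x =>
    abs_unitNormal_apply_le_one u x l

theorem abs_sInt_withDensityᵥ_unitNormal_sub_le {u : Euc d → ℝ} (hu : ContDiff ℝ 1 u)
    {μ : Measure (Euc d)} [IsFiniteMeasure μ] (l : Fin d) {f g : Euc d → ℝ} (hf : Measurable f)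
    (hg : Measurable g) {C ε : ℝ} (hfC : ∀ x, |f x| ≤ C) (hgC : ∀ x, |g x| ≤ C)
    (hε : ∀ x, |f x - g x| ≤ ε) :
    |sInt (μ.withDensityᵥ fun x => unitNormal u x l) f -
      sInt (μ.withDensityᵥ fun x => unitNormal u x l) g| ≤ ε * μ.real Set.univ := by
  have hi := integrable_unitNormal_apply hu μ l
  rw [sInt_eq_integral_mul hi hf hfC, sInt_eq_integral_mul hi hg hgC,
    ← integral_sub (hi.bdd_mul (c := C) hf.aestronglyMeasurable (ae_of_all _ hfC))
      (hi.bdd_mul (c := C) hg.aestronglyMeasurable (ae_of_all _ hgC))]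
  refine norm_integral_le_of_norm_le_const (μ := μ)
    (f := fun x => f x * unitNormal u x l - g x * unitNormal u x l) (ae_of_all _ fun x => ?_)
  rw [← sub_mul, norm_mul]
  exact (mul_le_of_le_one_right (norm_nonneg _) (abs_unitNormal_apply_le_one u x l)).trans (hε x)

/-- Almost every superlevel set of `u` has finite perimeter, and the perimeters integrate to at
most the total variation of `u`. -/
theorem exists_superlevel_gradient_measures {u : Euc d → ℝ} (hu : ContDiff ℝ 1 u)
    (hc : HasCompactSupport u) {M : ℝ} (hM : ∀ x, |u x| < M) :
    ∃ (p : ℝ → ℝ) (ν : ℝ → Fin d → SignedMeasure (Euc d)), (∀ t, 0 ≤ p t) ∧ Integrable p ∧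
      ∫ t, p t ≤ ∫ x, ‖gradient u x‖ ∧ (∀ᵐ t, IsDistGrad d (ind {x | t < u x}) (ν t)) ∧
      (∀ t, vvar (ν t) Set.univ ≤ ENNReal.ofReal (p t)) ∧
      ∀ (t : ℝ) (l : Fin d) (f g : Euc d → ℝ) (C ε : ℝ), Measurable f → Measurable g →
        (∀ x, |f x| ≤ C) → (∀ x, |g x| ≤ C) → (∀ x, |f x - g x| ≤ ε) →
        |sInt (ν t l) f - sInt (ν t l) g| ≤ ε * p t := by
  obtain ⟨p, κ, hp0, hpi, hple, hκ, H⟩ := exists_superlevel_disintegration hu hc hM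
  set μ : ℝ → Measure (Euc d) := fun t => ENNReal.ofReal (p t) • κ t with hμ
  have hμu : ∀ t, μ t Set.univ = ENNReal.ofReal (p t) := fun t => by simp [hμ]
  have hμfin : ∀ t, IsFiniteMeasure (μ t) := fun t => ⟨by simp [hμu]⟩
  have hμr : ∀ t, (μ t).real Set.univ = p t := fun t => by
    rw [Measure.real, hμu, ENNReal.toReal_ofReal (hp0 t)]
  refine ⟨p, fun t l => (μ t).withDensityᵥ fun x => unitNormal u x l, hp0, hpi, hple, ?_,
    fun t => (vvar_withDensityᵥ_le (measurable_unitNormal hu)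
      (norm_unitNormal_le_one u)).trans_eq (hμu t),
    fun t l f g C ε hf hg hfC hgC hε => by
      rw [← hμr t]
      exact abs_sInt_withDensityᵥ_unitNormal_sub_le hu l hf hg hfC hgC hε⟩
  filter_upwards [H] with t ht l φ hφ hφc
  have hφ1 : ContDiff ℝ 1 φ := hφ.of_le (by exact_mod_cast le_top)
  obtain ⟨C, hC⟩ := hφc.exists_bound_of_continuous hφ1.continuous
  rw [sInt_eq_integral_mul (integrable_unitNormal_apply hu (μ t) l) hφ1.continuous.measurable hC,
    hμ, integral_smul_measure, ENNReal.toReal_ofReal (hp0 t), smul_eq_mul, ← ht l φ hφ1 hφc,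
    ← integral_indicator (measurableSet_superlevel hu.continuous t)]
  refine integral_congr_ae (ae_of_all _ fun x => ?_)
  by_cases hx : t < u x <;> simp [ind, hx]

end LevelMeasure

section RiemannSums

/-- In every nondegenerate interval there is a point where `p` does not exceed its average and
where a given almost sure property holds. -/
theorem exists_mem_Ioc_mul_le_integral {p : ℝ → ℝ} (hp : Integrable p) {Q : ℝ → Prop}
    (hQ : ∀ᵐ t, Q t) {a b : ℝ} (hab : a < b) :
    ∃ t ∈ Set.Ioc a b, Q t ∧ (b - a) * p t ≤ ∫ s in a..b, p s := by
  have h := measure_le_setAverage_pos (μ := volume) (s := Set.Ioc a b) (f := p)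
    (by simp [hab]) (by simp) hp.integrableOn
  obtain ⟨t, ⟨ht, hle⟩, htQ⟩ := ((frequently_ae_iff.2 h.ne').and_eventually hQ).exists
  refine ⟨t, ht, htQ, ?_⟩
  have hpos : 0 < b - a := sub_pos.2 hab
  rw [setAverage_eq, smul_eq_mul, Real.volume_real_Ioc_of_le hab.le] at hle
  rw [intervalIntegral.integral_of_le hab.le]
  calc (b - a) * p t ≤ (b - a) * ((b - a)⁻¹ * ∫ s in Set.Ioc a b, p s) :=
        mul_le_mul_of_nonneg_left hle hpos.le
    _ = ∫ s in Set.Ioc a b, p s := by rw [← mul_assoc, mul_inv_cancel₀ hpos.ne', one_mul]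

theorem abs_riemannSum_sub_integral_le_of_antitone {G : ℝ → ℝ} (hG : Antitone G) {x t : ℕ → ℝ}
    {δ : ℝ} (hδ : 0 ≤ δ) (hx : ∀ k, x (k + 1) = x k + δ)
    (ht : ∀ k, t k ∈ Set.Ioc (x k) (x (k + 1))) (n : ℕ) :
    |∑ k ∈ Finset.range n, δ * G (t k) - ∫ s in (x 0)..(x n), G s| ≤ δ * (G (x 0) - G (x n)) := by
  have hint : ∀ a b, IntervalIntegrable G volume a b := fun a b =>
    (hG.antitoneOn _).intervalIntegrable
  rw [← intervalIntegral.sum_integral_adjacent_intervals fun k _ => hint _ _,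
    ← Finset.sum_sub_distrib, ← Finset.sum_range_sub' (fun k => G (x k)), Finset.mul_sum]
  refine (Finset.abs_sum_le_sum_abs _ _).trans (Finset.sum_le_sum fun k _ => ?_)
  have hle : x k ≤ x (k + 1) := by rw [hx]; linarith
  have hd : x (k + 1) - x k = δ := by rw [hx]; ring
  have h1 := intervalIntegral.integral_mono_on hle (hint _ _)
    (intervalIntegrable_const (c := G (x k))) fun s hs => hG hs.1
  have h2 := intervalIntegral.integral_mono_on hle
    (intervalIntegrable_const (c := G (x (k + 1)))) (hint _ _) fun s hs => hG hs.2
  rw [intervalIntegral.integral_const, hd, smul_eq_mul] at h1 h2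
  have h3 := mul_le_mul_of_nonneg_left (hG (ht k).1.le) hδ
  have h4 := mul_le_mul_of_nonneg_left (hG (ht k).2) hδ
  rw [abs_le, mul_sub]
  constructor <;> linarith

/-- The nodes of the uniform partition of `[-M, M]` into `n` intervals. -/
def node (M : ℝ) (n k : ℕ) : ℝ := -M + k * (2 * M / n)

theorem node_zero (M : ℝ) (n : ℕ) : node M n 0 = -M := by simp [node]

theorem node_self (M : ℝ) {n : ℕ} (hn : 0 < n) : node M n n = M := by
  have : (n : ℝ) ≠ 0 := by exact_mod_cast hn.ne'
  rw [node]
  field_simp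
  ring

theorem node_succ (M : ℝ) (n k : ℕ) : node M n (k + 1) = node M n k + 2 * M / n := by
  rw [node, node]
  push_cast
  ring

theorem tendsto_riemannSum_of_antitone {G : ℝ → ℝ} (hG : Antitone G) {M : ℝ} (hM : 0 < M)
    {t : ℕ → ℕ → ℝ}
    (ht : ∀ n k, 0 < n → t n k ∈ Set.Ioc (node M n k) (node M n (k + 1))) :
    Tendsto (fun n : ℕ => ∑ k ∈ Finset.range n, 2 * M / n * G (t n k)) atTop
      (𝓝 (∫ s in (-M)..M, G s)) := by
  rw [tendsto_iff_dist_tendsto_zero]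
  have h0 : Tendsto (fun n : ℕ => 2 * M / n * (G (-M) - G M)) atTop (𝓝 0) := by
    simpa using (tendsto_const_div_atTop_nhds_zero_nat (2 * M)).mul_const (G (-M) - G M)
  refine squeeze_zero' (Eventually.of_forall fun n => dist_nonneg) ?_ h0
  filter_upwards [eventually_gt_atTop 0] with n hn
  have h := abs_riemannSum_sub_integral_le_of_antitone hG (δ := 2 * M / n) (by positivity)
    (node_succ M n) (fun k => ht n k hn) n
  rwa [node_zero, node_self M hn] at h

theorem riemannSum_le_integral {p : ℝ → ℝ} (hp : Integrable p) (hp0 : ∀ t, 0 ≤ p t) {M : ℝ}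
    (hM : 0 < M) {t : ℕ → ℝ} {n : ℕ}
    (ht : ∀ k, 0 < n → 2 * M / n * p (t k) ≤ ∫ s in (node M n k)..(node M n (k + 1)), p s) :
    ∑ k ∈ Finset.range n, 2 * M / n * p (t k) ≤ ∫ s, p s := by
  rcases n.eq_zero_or_pos with rfl | hn
  · simpa using integral_nonneg hp0
  · refine (Finset.sum_le_sum fun k _ => ht k hn).trans ?_
    rw [intervalIntegral.sum_integral_adjacent_intervals fun k _ => hp.intervalIntegrable,
      node_zero, node_self M hn, intervalIntegral.integral_of_le (by linarith)]
    exact setIntegral_le_integral hp (ae_of_all _ hp0)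

end RiemannSums

section Assembly

variable {d : ℕ}

theorem antitone_setIntegral_superlevel {u h : Euc d → ℝ} (hh : Integrable h) (h0 : ∀ x, 0 ≤ h x) :
    Antitone fun t => ∫ x in {x | t < u x}, h x := fun _ _ hst =>
  setIntegral_mono_set hh.integrableOn (ae_of_all _ h0)
    (LE.le.eventuallyLE fun _ hx => hst.trans_lt hx)

/-- Riemann sums of the function `t ↦ ∫ x in {x | t < u x}, h x` converge. -/
theorem tendsto_riemannSum_setIntegral_superlevel {u h : Euc d → ℝ} (hh : Integrable h) {M : ℝ}
    (hM : 0 < M) {t : ℕ → ℕ → ℝ}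
    (ht : ∀ n k, 0 < n → t n k ∈ Set.Ioc (node M n k) (node M n (k + 1))) :
    Tendsto (fun n : ℕ => ∑ k ∈ Finset.range n, 2 * M / n * ∫ x in {x | t n k < u x}, h x) atTop
      (𝓝 (∫ s in (-M)..M, ∫ x in {x | s < u x}, h x)) := by
  have ha := antitone_setIntegral_superlevel (u := u) hh.pos_part fun x => le_max_right _ _
  have hb := antitone_setIntegral_superlevel (u := u) hh.neg_part fun x => le_max_right _ _
  have hsub : ∀ s, ∫ x in {x | s < u x}, h x =
      (∫ x in {x | s < u x}, max (h x) 0) - ∫ x in {x | s < u x}, max (-h x) 0 := fun s => by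
    rw [← integral_sub hh.pos_part.integrableOn hh.neg_part.integrableOn]
    refine integral_congr_ae (ae_of_all _ fun x => ?_)
    exact (posPart_sub_negPart (h x)).symm
  simp_rw [hsub]
  rw [intervalIntegral.integral_sub (ha.antitoneOn _).intervalIntegrable
    (hb.antitoneOn _).intervalIntegrable]
  simp_rw [mul_sub, Finset.sum_sub_distrib]
  exact (tendsto_riemannSum_of_antitone ha hM ht).sub (tendsto_riemannSum_of_antitone hb hM ht)

theorem exists_test_function_approx {f : Euc d → ℝ} (hf : Continuous f)
    (h0 : Tendsto f (cocompact (Euc d)) (𝓝 0)) {ε : ℝ} (hε : 0 < ε) :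
    ∃ φ : Euc d → ℝ, ContDiff ℝ (⊤ : ℕ∞) φ ∧ HasCompactSupport φ ∧ ∀ x, |f x - φ x| ≤ ε := by
  set c : Euc d → ℝ := fun x => max (-(ε / 2)) (min (ε / 2) (f x)) with hc
  have hcc : Continuous c := continuous_const.max (continuous_const.min hf)
  have hcε : ∀ x, |c x| ≤ ε / 2 := fun x => by
    rw [abs_le]
    exact ⟨le_max_left _ _, max_le (by linarith) (min_le_left _ _)⟩
  have hev : ∀ᶠ x in cocompact (Euc d), |f x| ≤ ε / 2 := by
    filter_upwards [h0.eventually (Metric.closedBall_mem_nhds (0 : ℝ) (half_pos hε))] with x hx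
    simpa using hx
  obtain ⟨K, hK, hKf⟩ := mem_cocompact.1 hev
  obtain ⟨φ, hφ, hφd, hφs⟩ := (hf.sub hcc).exists_contDiff_approx (ε := fun _ => ε / 2) ⊤
    continuous_const fun _ => half_pos hε
  refine ⟨φ, hφ, HasCompactSupport.intro hK fun x hx => ?_, fun x => ?_⟩
  · by_contra h
    have h1 : f x - c x ≠ 0 := hφs h
    have h2 : |f x| ≤ ε / 2 := hKf hx
    rw [abs_le] at h2
    refine h1 ?_
    simp only [hc]
    rw [min_eq_right h2.2, max_eq_right h2.1, sub_self]
  · have h1 := (hφd x).le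
    have h2 := hcε x
    rw [Real.dist_eq, abs_le] at h1
    rw [abs_le] at h2 ⊢
    simp only [Pi.sub_apply] at h1
    constructor <;> linarith [h1.1, h1.2, h2.1, h2.2]

/-- Weak-star convergence of one component of the Riemann sums of level set gradients. -/
theorem tendsto_riemannSum_sInt {u : Euc d → ℝ} (hu : ContDiff ℝ 1 u) (hc : HasCompactSupport u)
    {M : ℝ} (hM0 : 0 < M) (hM : ∀ x, |u x| < M) {p : ℝ → ℝ} {ν : ℝ → Fin d → SignedMeasure (Euc d)}
    (hple : ∫ t, p t ≤ ∫ x, ‖gradient u x‖)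
    (hν : ∀ (t : ℝ) (l : Fin d) (f g : Euc d → ℝ) (C ε : ℝ), Measurable f → Measurable g →
        (∀ x, |f x| ≤ C) → (∀ x, |g x| ≤ C) → (∀ x, |f x - g x| ≤ ε) →
        |sInt (ν t l) f - sInt (ν t l) g| ≤ ε * p t)
    {t : ℕ → ℕ → ℝ}
    (ht : ∀ n k, 0 < n → t n k ∈ Set.Ioc (node M n k) (node M n (k + 1)))
    (htν : ∀ n k, 0 < n → IsDistGrad d (ind {x | t n k < u x}) (ν (t n k)))
    (hsum : ∀ n : ℕ, ∑ k ∈ Finset.range n, 2 * M / n * p (t n k) ≤ ∫ s, p s)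
    (l : Fin d) {f : Euc d → ℝ} (hf : Continuous f) (hf0 : Tendsto f (cocompact (Euc d)) (𝓝 0)) :
    Tendsto (fun n : ℕ => ∑ k ∈ Finset.range n, 2 * M / n * sInt (ν (t n k) l) f) atTop
      (𝓝 (∫ x, f x * fderiv ℝ u x (EuclideanSpace.single l 1))) := by
  set v : Euc d := EuclideanSpace.single l 1 with hv
  set P : ℝ := ∫ x, ‖gradient u x‖ with hP
  have hP0 : 0 ≤ P := integral_nonneg fun x => norm_nonneg _
  have hDu := integrable_fderiv_apply hu hc v
  have htest : ∀ φ : Euc d → ℝ, ContDiff ℝ (⊤ : ℕ∞) φ → HasCompactSupport φ →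
      Tendsto (fun n : ℕ => ∑ k ∈ Finset.range n, 2 * M / n * sInt (ν (t n k) l) φ) atTop
        (𝓝 (∫ x, φ x * fderiv ℝ u x v)) := fun φ hφ hφc => by
    have hφ1 : ContDiff ℝ 1 φ := hφ.of_le (by exact_mod_cast le_top)
    have h1 := integral_comp_mul_mul_fderiv hu hφ1 hφc v hM (continuous_const (y := (1 : ℝ)))
    simp only [one_mul, integral_neg] at h1
    rw [h1, ← setIntegral_eq_integral_of_forall_compl_eq_zero fun s hs =>
      setIntegral_superlevel_fderiv_eq_zero hφ1 hφc v hM hs,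
      ← intervalIntegral.integral_of_le (by linarith)]
    refine (tendsto_riemannSum_setIntegral_superlevel (u := u)
      (integrable_fderiv_apply hφ1 hφc v) hM0 ht).neg.congr fun n => ?_
    rw [← Finset.sum_neg_distrib]
    refine Finset.sum_congr rfl fun k hk => ?_
    rw [← mul_neg, neg_eq_iff_eq_neg.2]
    rw [← htν n k ((Nat.zero_le k).trans_lt (Finset.mem_range.1 hk)) l φ hφ hφc,
      ← integral_indicator (measurableSet_superlevel hu.continuous _)]
    refine integral_congr_ae (ae_of_all _ fun x => ?_)
    by_cases hx : t n k < u x <;> simp [ind, hx, hv]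
  rw [Metric.tendsto_atTop']
  intro ε hε
  obtain ⟨η, hη, hηε⟩ : ∃ η > 0, η * P + η + η * P < ε := by
    refine ⟨ε / (2 * (2 * P + 1)), by positivity, ?_⟩
    have : ε / (2 * (2 * P + 1)) * P + ε / (2 * (2 * P + 1)) + ε / (2 * (2 * P + 1)) * P =
      ε / 2 := by field_simp; ring
    linarith
  obtain ⟨φ, hφ, hφc, hφf⟩ := exists_test_function_approx hf hf0 hη
  obtain ⟨N, hN⟩ := (Metric.tendsto_atTop'.1 (htest φ hφ hφc)) η hη
  refine ⟨N, fun n hn => ?_⟩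
  obtain ⟨C, hC⟩ := hφc.exists_bound_of_continuous hφ.continuous
  have hfC : ∀ x, |f x| ≤ C + η := fun x => by
    have h1 := hφf x
    have h2 : |φ x| ≤ C := hC x
    rw [abs_le] at h1 h2 ⊢
    constructor <;> linarith [h1.1, h1.2, h2.1, h2.2]
  have hφC : ∀ x, |φ x| ≤ C + η := fun x => (hC x).trans (by linarith)
  have e1 : |∑ k ∈ Finset.range n, 2 * M / n * sInt (ν (t n k) l) f -
      ∑ k ∈ Finset.range n, 2 * M / n * sInt (ν (t n k) l) φ| ≤ η * P := by
    rw [← Finset.sum_sub_distrib]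
    refine (Finset.abs_sum_le_sum_abs _ _).trans ?_
    refine le_trans (Finset.sum_le_sum fun k _ => ?_)
      ((Finset.mul_sum _ _ η).symm.le.trans
        (mul_le_mul_of_nonneg_left ((hsum n).trans hple) hη.le))
    have hδ : 0 ≤ 2 * M / (n : ℝ) := by positivity
    rw [← mul_sub, abs_mul, abs_of_nonneg hδ, mul_left_comm]
    exact mul_le_mul_of_nonneg_left
      (hν _ l f φ _ _ hf.measurable hφ.continuous.measurable hfC hφC hφf) hδ
  have e2 := hN n hn
  have e3 : |(∫ x, f x * fderiv ℝ u x v) - ∫ x, φ x * fderiv ℝ u x v| ≤ η * P := by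
    rw [← integral_sub (hDu.bdd_mul (c := C + η) hf.aestronglyMeasurable (ae_of_all _ hfC))
      (hDu.bdd_mul (c := C + η) hφ.continuous.aestronglyMeasurable (ae_of_all _ hφC)),
      hP, ← integral_const_mul]
    refine norm_integral_le_of_norm_le
      (f := fun x => f x * fderiv ℝ u x v - φ x * fderiv ℝ u x v)
      ((integrable_norm_gradient hu hc).const_mul η) (ae_of_all _ fun x => ?_)
    rw [← sub_mul, norm_mul, hv, ← gradient_apply]
    exact mul_le_mul (hφf x) (PiLp.norm_apply_le (gradient u x) l) (norm_nonneg _) hη.le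
  rw [Real.dist_eq] at e2 ⊢
  rw [abs_le] at e1 e3
  rw [abs_lt] at e2 ⊢
  constructor <;> linarith [e1.1, e1.2, e2.1, e2.2, e3.1, e3.2]

/-- Almost every level is regular. -/
theorem ae_fderiv_ne_zero_of_eq {u : Euc d → ℝ} (hu : ContDiff ℝ (⊤ : ℕ∞) u) :
    ∀ᵐ t, ∀ x, u x = t → fderiv ℝ u x ≠ 0 := by
  obtain ⟨N, -, hN⟩ := exists_volume_image_critical_eq_zero d
  have h := hN (Euc d) finrank_euclideanSpace_fin u {x | fderiv ℝ u x = 0} fun x hx =>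
    ⟨hu.contDiffAt.of_le (by exact_mod_cast le_top), hx⟩
  filter_upwards [measure_eq_zero_iff_ae_notMem.1 h] with t ht x hx h0
  exact ht ⟨x, h0, hx⟩

end Assembly

/-- weak-star convergence of level-set Riemann sums (the sampling lemma). -/
theorem stmt13 (d : ℕ) (hd : 1 ≤ d) (u : Euc d → ℝ)
    (hu : ContDiff ℝ (⊤ : ℕ∞) u) (hc : HasCompactSupport u) :
    ∃ (Ω : (n : ℕ) → Fin n → Set (Euc d)) (a : (n : ℕ) → Fin n → ℝ)
      (ν : (n : ℕ) → Fin n → Fin d → MeasureTheory.SignedMeasure (Euc d)),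
      (∀ n i, IsOpen (Ω n i)) ∧
      (∀ n i, ∃ s : ℝ, Ω n i = {x | u x > s} ∧ ∀ x, u x = s → fderiv ℝ u x ≠ 0) ∧
      (∀ n i, IsDistGrad d (ind (Ω n i)) (ν n i)) ∧
      (∀ Φ : Euc d → Euc d, Continuous Φ → Tendsto Φ (cocompact (Euc d)) (𝓝 0) →
        Tendsto (fun n => ∑ i : Fin n, a n i * ∑ l, sInt (ν n i l) (fun x => Φ x l))
          atTop (𝓝 (∫ x, ⟪Φ x, gradient u x⟫))) ∧
      Filter.limsup
          (fun n => ∑ i : Fin n, |a n i| * (vvar (ν n i) Set.univ).toReal) atTop ≤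
        ∫ x, ‖gradient u x‖ := by
  have hu1 : ContDiff ℝ 1 u := hu.of_le (by exact_mod_cast le_top)
  obtain ⟨C, hC⟩ := hc.exists_bound_of_continuous hu.continuous
  set M : ℝ := |C| + 1 with hMdef
  have hM0 : 0 < M := by positivity
  have hM : ∀ x, |u x| < M := fun x =>
    (hC x).trans_lt ((le_abs_self C).trans_lt (lt_add_one _))
  obtain ⟨p, ν, hp0, hpi, hple, hgrad, hvar, hν⟩ := exists_superlevel_gradient_measures hu1 hc hM
  have hchoice : ∀ n k : ℕ, ∃ t, 0 < n → t ∈ Set.Ioc (node M n k) (node M n (k + 1)) ∧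
      (IsDistGrad d (ind {x | t < u x}) (ν t) ∧ ∀ x, u x = t → fderiv ℝ u x ≠ 0) ∧
      2 * M / n * p t ≤ ∫ s in (node M n k)..(node M n (k + 1)), p s := fun n k => by
    rcases n.eq_zero_or_pos with rfl | hn
    · exact ⟨0, fun h => absurd h (lt_irrefl 0)⟩
    · have hδ : 0 < 2 * M / (n : ℝ) := by positivity
      obtain ⟨t, h1, h2, h3⟩ := exists_mem_Ioc_mul_le_integral hpi
        (hgrad.and (ae_fderiv_ne_zero_of_eq hu))
        (show node M n k < node M n (k + 1) by rw [node_succ]; linarith)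
      rw [node_succ, add_sub_cancel_left, ← node_succ] at h3
      exact ⟨t, fun _ => ⟨h1, h2, h3⟩⟩
  choose t ht using hchoice
  have hpos : ∀ {n : ℕ} (_ : Fin n), 0 < n := fun i => (Nat.zero_le _).trans_lt i.2
  have hsum : ∀ n : ℕ, ∑ k ∈ Finset.range n, 2 * M / n * p (t n k) ≤ ∫ s, p s := fun n =>
    riemannSum_le_integral hpi hp0 hM0 fun k hn => (ht n k hn).2.2
  refine ⟨fun n i => {x | u x > t n i}, fun n _ => 2 * M / n, fun n i => ν (t n i),
    fun n i => isOpen_lt continuous_const hu.continuous,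
    fun n i => ⟨t n i, rfl, (ht n i (hpos i)).2.1.2⟩, fun n i => (ht n i (hpos i)).2.1.1,
    fun Φ hΦ hΦ0 => ?_, ?_⟩
  · have hcoord : ∀ l, Continuous fun x => Φ x l := fun l =>
      (EuclideanSpace.proj (𝕜 := ℝ) l).continuous.comp hΦ
    have hlim := tendsto_finsetSum Finset.univ fun l _ =>
      tendsto_riemannSum_sInt hu1 hc hM0 hM hple hν (fun n k hn => (ht n k hn).1)
        (fun n k hn => (ht n k hn).2.1.1) hsum l (hcoord l)
        (((EuclideanSpace.proj (𝕜 := ℝ) l).continuous.tendsto 0).comp hΦ0)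
    have hint : ∫ x, ⟪Φ x, gradient u x⟫ =
        ∑ l, ∫ x, Φ x l * fderiv ℝ u x (EuclideanSpace.single l 1) := by
      have hi : ∀ l, Integrable fun x => Φ x l * fderiv ℝ u x (EuclideanSpace.single l 1) :=
        fun l => ((hcoord l).mul ((hu1.continuous_fderiv one_ne_zero).clm_apply
          continuous_const)).integrable_of_hasCompactSupport (hc.fderiv_apply ℝ _).mul_left
      rw [← integral_finsetSum _ fun l _ => hi l]
      refine integral_congr_ae (ae_of_all _ fun x => ?_)
      simp only [PiLp.inner_apply, ← gradient_apply, RCLike.inner_apply, conj_trivial, mul_comm]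
    rw [hint]
    refine hlim.congr fun n => ?_
    rw [Finset.sum_comm, ← Fin.sum_univ_eq_sum_range
      (fun k => ∑ l, 2 * M / n * sInt (ν (t n k) l) fun x => Φ x l)]
    simp only [Finset.mul_sum]
  · have hnn : ∀ n : ℕ, 0 ≤ ∑ i : Fin n, |2 * M / (n : ℝ)| *
        (vvar (ν (t n i)) Set.univ).toReal := fun n => by positivity
    refine limsup_le_of_le (isCoboundedUnder_le_of_le _ hnn) (Eventually.of_forall fun n => ?_)
    refine le_trans ?_ ((hsum n).trans hple)
    rw [← Fin.sum_univ_eq_sum_range (fun k => 2 * M / (n : ℝ) * p (t n k))]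
    refine Finset.sum_le_sum fun i _ => ?_
    have hδ : 0 ≤ 2 * M / (n : ℝ) := by positivity
    rw [abs_of_nonneg hδ]
    exact mul_le_mul_of_nonneg_left (ENNReal.toReal_le_of_le_ofReal (hp0 _) (hvar _)) hδ
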